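/- arXiv:2010.12039 — 2 statements merged into one kernel-verified Lean document; each statement's English description precedes it below -/
import Mathlib

section
/- Let H ⊆ Y^X be a hypothesis class with finite dual VC dimension d* = vc*(H), and for k ≥ 2 let co^k(H) = {x ↦ MAJ(h_1,…,h_k)(x) : h_1,…,h_k ∈ H} be the class of majority votes of k members of H. Then the dual VC dimension of co^k(H) satisfies vc*(co^k(H)) ≤ C·d*·log k for a universal constant C. -/
open scoped ENNReal BigOperators
open MeasureTheory

attribute [local instance] Classical.propDecidable

/-- Standard 0-1 error of a hypothesis `h` under a distribution `D` over `X × Bool`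
(labels `true = +1`, `false = -1`). -/
noncomputable def errP {X : Type} (D : PMF (X × Bool)) (h : X → Bool) : ℝ≥0∞ :=
  ∑' p : X × Bool, D p * (if h p.1 ≠ p.2 then 1 else 0)

/-- Robust risk `R_U(h; D) = E_{(x,y)∼D}[sup_{z ∈ U(x)} 1[h(z) ≠ y]]`. -/
noncomputable def robustRisk {X : Type} (U : X → Set X) (D : PMF (X × Bool))
    (h : X → Bool) : ℝ≥0∞ :=
  ∑' p : X × Bool, D p * (if ∃ z ∈ U p.1, h z ≠ p.2 then 1 else 0)

/-- The distribution of an i.i.d. sample of size `m` from `D`. -/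
noncomputable def iidPMF {α : Type} (D : PMF α) : (m : ℕ) → PMF (Fin m → α)
  | 0 => PMF.pure (fun i => i.elim0)
  | m + 1 => D.bind fun a => (iidPMF D m).map fun f => Fin.cons a f

/-- `H` shatters the finite set `s` of points. -/
def Shatters {X : Type} (H : Set (X → Bool)) (s : Finset X) : Prop :=
  ∀ σ : X → Bool, ∃ h ∈ H, ∀ x ∈ s, h x = σ x

/-- The VC dimension of `H` is at most `d`. -/
def VCDimLE {X : Type} (H : Set (X → Bool)) (d : ℕ) : Prop :=
  ∀ s : Finset X, Shatters H s → s.card ≤ d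

/-- The finite set `F` of hypotheses from `H` is shattered by points of `X`
(dual shattering). -/
def DualShatters {X : Type} (H : Set (X → Bool)) (F : Finset (X → Bool)) : Prop :=
  ↑F ⊆ H ∧ ∀ σ : (X → Bool) → Bool, ∃ x : X, ∀ h ∈ F, h x = σ h

/-- The dual VC dimension of `H` is at most `d`. -/
def DualVCDimLE {X : Type} (H : Set (X → Bool)) (d : ℕ) : Prop :=
  ∀ F : Finset (X → Bool), DualShatters H F → F.card ≤ d

/-- `A` PAC learns the class `C` with sample complexity `mA` (realizable case). -/
def PACLearner {X : Type} (C : Set (X → Bool)) (A : List (X × Bool) → X → Bool)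
    (mA : ℝ → ℝ → ℕ) : Prop :=
  ∀ ε δ : ℝ, 0 < ε → ε < 1 → 0 < δ → δ < 1 →
    ∀ D : PMF (X × Bool), (∃ c ∈ C, errP D c = 0) →
      (iidPMF D (mA ε δ)).toOuterMeasure
          {S | errP D (A (List.ofFn S)) ≤ ENNReal.ofReal ε} ≥ 1 - ENNReal.ofReal δ

/-- Majority vote of `k` hypotheses, i.e. `sign (∑ i, h i x)` with the convention
`sign 0 = +1` (`true`). -/
def maj {X : Type} {k : ℕ} (h : Fin k → X → Bool) (x : X) : Bool :=
  decide (k ≤ 2 * (Finset.univ.filter fun i => h i x = true).card)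

/-- `co^k(H)`: all majority votes of `k` members of `H`. -/
def coVotes {X : Type} (H : Set (X → Bool)) (k : ℕ) : Set (X → Bool) :=
  {f | ∃ h : Fin k → X → Bool, (∀ i, h i ∈ H) ∧ f = maj h}

/-- The set of indices of the hypotheses in a family `g` that accept the point `x`. -/
noncomputable def acceptors {X ι : Type} [Fintype ι] (g : ι → X → Bool) (x : X) : Finset ι :=
  Finset.univ.filter fun p => g p x = true

/-- The traces on a finite family of hypotheses of all the points of `X`. -/
noncomputable def traces {X ι : Type} [Fintype ι] (g : ι → X → Bool) : Finset (Finset ι) :=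
  Finset.univ.filter fun s => ∃ x, acceptors g x = s

lemma acceptors_mem_traces {X ι : Type} [Fintype ι] (g : ι → X → Bool) (x : X) :
    acceptors g x ∈ traces g := by
  simp [traces]

/-- A family of indices shattered by the traces has at most `d` elements. -/
lemma card_le_of_traces_shatters {X ι : Type} [Fintype ι] {H : Set (X → Bool)} {d : ℕ}
    (hd : DualVCDimLE H d) (g : ι → X → Bool) (hg : ∀ p, g p ∈ H) {s : Finset ι}
    (hs : (traces g).Shatters s) : s.card ≤ d := by
  have key : ∀ t ⊆ s, ∃ x, ∀ p ∈ s, (g p x = true ↔ p ∈ t) := by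
    intro t ht
    obtain ⟨u, hu, hut⟩ := hs ht
    obtain ⟨x, rfl⟩ : ∃ x, acceptors g x = u := by simpa [traces] using hu
    refine ⟨x, fun p hp => ?_⟩
    rw [← hut]
    simp [acceptors, hp]
  have hinj : Set.InjOn g s := by
    intro p hp q hq hpq
    obtain ⟨x, hx⟩ := key {p} (by simpa using hp)
    have h1 := hx p hp
    have h2 := hx q hq
    rw [← hpq] at h2
    simpa [eq_comm] using h2.symm.trans h1
  rw [← Finset.card_image_of_injOn hinj]
  refine hd _ ⟨fun h hh => ?_, fun σ => ?_⟩
  · obtain ⟨p, -, rfl⟩ := Finset.mem_image.1 (Finset.mem_coe.1 hh)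
    exact hg p
  · obtain ⟨x, hx⟩ := key (s.filter fun p => σ (g p) = true) (Finset.filter_subset _ _)
    refine ⟨x, fun h hh => ?_⟩
    obtain ⟨p, hp, rfl⟩ := Finset.mem_image.1 hh
    have := hx p hp
    simp only [Finset.mem_filter, hp, true_and] at this
    exact Bool.eq_iff_iff.2 this

/-- A Sauer–Shelah bound: a family of sets shattering only sets of size at most `d` satisfies
`t ^ d * #𝒜 ≤ (1 + t) ^ #ι` for all `t ∈ [0, 1]`. -/
lemma pow_mul_card_le_of_shatters_card_le {ι : Type} [Fintype ι] {𝒜 : Finset (Finset ι)} {d : ℕ}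
    (h𝒜 : ∀ s, 𝒜.Shatters s → s.card ≤ d) {t : ℝ} (ht0 : 0 ≤ t) (ht1 : t ≤ 1) :
    t ^ d * 𝒜.card ≤ (1 + t) ^ Fintype.card ι := by
  calc t ^ d * 𝒜.card ≤ t ^ d * 𝒜.shatterer.card := by
        have := Finset.card_le_card_shatterer 𝒜
        exact mul_le_mul_of_nonneg_left (by exact_mod_cast this) (by positivity)
    _ = ∑ s ∈ 𝒜.shatterer, t ^ d := by rw [Finset.sum_const, nsmul_eq_mul, mul_comm]
    _ ≤ ∑ s ∈ 𝒜.shatterer, t ^ s.card := Finset.sum_le_sum fun s hs =>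
        pow_le_pow_of_le_one ht0 ht1 (h𝒜 s (Finset.mem_shatterer.1 hs))
    _ ≤ ∑ s : Finset ι, t ^ s.card :=
        Finset.sum_le_sum_of_subset_of_nonneg (Finset.subset_univ _) fun _ _ _ => by positivity
    _ = (1 + t) ^ Fintype.card ι := by
        rw [add_comm, ← Fintype.sum_pow_mul_eq_add_pow]
        simp

/-- A dual-shattered set of majority votes induces at least `2 ^ #F` traces on its voters. -/
lemma two_pow_card_le_card_traces {X : Type} {k : ℕ} {F : Finset (X → Bool)}
    (h : (X → Bool) → Fin k → X → Bool) (hh : ∀ f ∈ F, f = maj (h f))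
    (hF : ∀ σ : (X → Bool) → Bool, ∃ x : X, ∀ f ∈ F, f x = σ f) :
    2 ^ F.card ≤ (traces fun p : F × Fin k => h p.1 p.2).card := by
  choose x hx using fun S : Finset (X → Bool) => hF fun f => decide (f ∈ S)
  rw [← Finset.card_powerset]
  refine Finset.card_le_card_of_injOn (fun S => acceptors _ (x S))
    (fun S _ => acceptors_mem_traces _ _) fun S hS T hT hST => ?_
  have hval : ∀ f ∈ F, f (x S) = f (x T) := by
    intro f hf
    have hvote : ∀ i, h f i (x S) = h f i (x T) := fun i => by
      have := Finset.ext_iff.1 hST (⟨f, hf⟩, i)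
      simpa [acceptors, ← Bool.eq_iff_iff] using this
    rw [hh f hf]
    simp only [maj, hvote]
  have hmem : ∀ f ∈ F, (f ∈ S ↔ f ∈ T) := by
    intro f hf
    have := hval f hf
    rwa [hx S f hf, hx T f hf, decide_eq_decide] at this
  ext f
  exact ⟨fun hf => (hmem f (Finset.mem_powerset.1 hS hf)).1 hf,
    fun hf => (hmem f (Finset.mem_powerset.1 hT hf)).2 hf⟩

/-- **Lemma 3.1 (dual VC of a convex hull).** If `vc*(H) ≤ d*` then every finite
set of majority votes of `k ≥ 2` members of `H` that is dual-shattered has size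
at most `C·d*·log k`; i.e. `vc*(co^k(H)) ≤ C·d*·log k` for a universal `C`. -/
theorem dualVC_of_majority_votes :
    ∃ Cc : ℝ, 0 < Cc ∧
      ∀ (X : Type) (H : Set (X → Bool)) (dstar : ℕ),
        DualVCDimLE H dstar →
        ∀ k : ℕ, 2 ≤ k →
          ∀ F : Finset (X → Bool), DualShatters (coVotes H k) F →
            (F.card : ℝ) ≤ Cc * dstar * Real.log k := by
  refine ⟨7, by norm_num, fun X H d hd k hk F ⟨hFH, hF⟩ => ?_⟩
  choose! h hH hmaj using fun f (hf : f ∈ F) => hFH hf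
  have hk2 : (2 : ℝ) ≤ k := by exact_mod_cast hk
  have hkpos : (0 : ℝ) < 4 * k := by linarith
  have hcard := two_pow_card_le_card_traces h hmaj hF
  have hsauer := pow_mul_card_le_of_shatters_card_le (t := 1 / (4 * k))
    (fun s hs => card_le_of_traces_shatters hd (fun p : F × Fin k => h p.1 p.2)
      (fun p => hH p.1 p.1.2 p.2) hs)
    (by positivity) ((div_le_one hkpos).2 (by linarith))
  have hgrowth : (1 / (4 * k) : ℝ) ^ d * 2 ^ F.card ≤ Real.exp (F.card / 4) := by
    calc (1 / (4 * k) : ℝ) ^ d * 2 ^ F.card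
        ≤ (1 / (4 * k) : ℝ) ^ d * (traces fun p : F × Fin k => h p.1 p.2).card := by
          gcongr
          exact_mod_cast hcard
      _ ≤ (1 + 1 / (4 * k) : ℝ) ^ (F.card * k) := by simpa using hsauer
      _ ≤ Real.exp (1 / (4 * k)) ^ (F.card * k) := by
          gcongr
          rw [add_comm]
          exact Real.add_one_le_exp _
      _ = Real.exp (F.card / 4) := by
          rw [← Real.exp_nat_mul]
          congr 1
          push_cast
          field_simp
  have hlog := Real.log_le_log (by positivity) hgrowth
  rw [Real.log_exp, Real.log_mul (by positivity) (by positivity), Real.log_pow, Real.log_pow,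
    one_div, Real.log_inv, Real.log_mul (by norm_num) (by positivity),
    show (4 : ℝ) = 2 ^ 2 by norm_num, Real.log_pow] at hlog
  have hlog2 : Real.log 2 ≤ Real.log k := Real.log_le_log (by norm_num) hk2
  have hd_mul := mul_le_mul_of_nonneg_left hlog2 d.cast_nonneg
  have hF_mul := mul_le_mul_of_nonneg_left Real.log_two_gt_d9.le (F.card.cast_nonneg (α := ℝ))
  push_cast at hlog
  nlinarith
end

section
/- (α-Boost guarantee.) Let S = {(x_1,y_1),…,(x_m,y_m)} ⊆ X × {−1,+1} with m ≥ 2, let T = ⌈112·ln m⌉, and let α = (1/2)·ln(1 + √(2·ln m / T)). Let D_1 be the uniform distribution on S, and suppose that for each t = 1,…,T a hypothesis h_t : X → {−1,+1} satisfies err_{D_t}(h_t) = Σ_{(x,y)∈S} D_t(x,y)·1[h_t(x) ≠ y] ≤ 1/3, where D_{t+1} is obtained from D_t by the multiplicative update D_{t+1}(x,y) = D_t(x,y)·e^{−2α·1[h_t(x)=y]} / Z_t with Z_t the normalization constant. Then for every (x,y) ∈ S, (1/T)·Σ_{t=1}^{T} 1[h_t(x) = y] ≥ 5/9; in particular the majority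 vote MAJ(h_1,…,h_T) classifies every point of S correctly. -/
open scoped ENNReal BigOperators
open MeasureTheory

attribute [local instance] Classical.propDecidable

/-- Under a weighting `w` whose mass outside `p` is at most `1/3`, damping the points of `p` by a
factor `1 + γ` brings the total mass down to at most `exp (γ / 3) / (1 + γ)`. -/
lemma sum_damped_le {ι : Type*} [Fintype ι] (w : ι → ℝ) (p : ι → Prop) [DecidablePred p]
    (hw : ∑ i, w i = 1) (herr : ∑ i, w i * (if p i then (0 : ℝ) else 1) ≤ 1 / 3)
    {γ : ℝ} (hγ : 0 ≤ γ) :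
    ∑ i, w i * Real.exp (-Real.log (1 + γ) * (if p i then 1 else 0)) ≤
      Real.exp (γ / 3 - Real.log (1 + γ)) := by
  have hpos : 0 < 1 + γ := by linarith
  have hsum : ∑ i, w i * Real.exp (-Real.log (1 + γ) * (if p i then 1 else 0)) =
      (1 + γ)⁻¹ * (1 + γ * ∑ i, w i * (if p i then (0 : ℝ) else 1)) := by
    have h1 : (1 : ℝ) + γ * ∑ i, w i * (if p i then (0 : ℝ) else 1) =
        ∑ i, (w i + γ * (w i * (if p i then (0 : ℝ) else 1))) := by
      rw [Finset.sum_add_distrib, hw, Finset.mul_sum]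
    rw [h1, Finset.mul_sum]
    refine Finset.sum_congr rfl fun i _ => ?_
    split_ifs
    · rw [mul_one, Real.exp_neg, Real.exp_log hpos]
      ring
    · rw [mul_zero, Real.exp_zero]
      field_simp
  rw [hsum, sub_eq_neg_add, Real.exp_add, Real.exp_neg, Real.exp_log hpos]
  gcongr
  nlinarith [Real.add_one_le_exp (γ / 3), mul_le_mul_of_nonneg_left herr hγ]

/-- After `n` rounds of multiplicative updates that lower the weight of the points of `p t`, the
weight of a point is at least its cumulated damping factor divided by the largest possible
product of the normalization constants. -/
lemma exp_neg_mul_card_le_weight {ι : Type*} [Fintype ι] (D : ℕ → ι → ℝ) (p : ℕ → ι → Prop)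
    [∀ t i, Decidable (p t i)] {N b B : ℝ} (n : ℕ) (hN : 0 < N)
    (hD0 : ∀ i, D 0 i = 1 / N) (hsum0 : ∑ i, D 0 i = 1)
    (hupd : ∀ t < n, ∀ i, D (t + 1) i = D t i * Real.exp (-b * (if p t i then 1 else 0)) /
      ∑ j, D t j * Real.exp (-b * (if p t j then 1 else 0)))
    (hB : ∀ t < n, ∑ i, D t i = 1 →
      ∑ j, D t j * Real.exp (-b * (if p t j then 1 else 0)) ≤ Real.exp B) :
    (∀ i, 0 < D n i) ∧ ∑ i, D n i = 1 ∧
      ∀ i, Real.exp (-b * ((Finset.range n).filter fun t => p t i).card) ≤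
        D n i * (N * Real.exp (n * B)) := by
  induction n with
  | zero => exact ⟨fun i => by rw [hD0]; positivity, hsum0, fun i => by simp [hD0, hN.ne']⟩
  | succ n ih =>
    obtain ⟨hpos, hsum, hle⟩ :=
      ih (fun t ht => hupd t (by omega)) (fun t ht => hB t (by omega))
    have hupd := hupd n n.lt_succ_self
    have hB := hB n n.lt_succ_self hsum
    have hne : (Finset.univ : Finset ι).Nonempty := by
      by_contra h
      simp [Finset.not_nonempty_iff_eq_empty.mp h] at hsum
    have hZ : 0 < ∑ j, D n j * Real.exp (-b * (if p n j then 1 else 0)) :=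
      Finset.sum_pos (fun j _ => mul_pos (hpos j) (Real.exp_pos _)) hne
    set Z := ∑ j, D n j * Real.exp (-b * (if p n j then 1 else 0)) with hZdef
    refine ⟨fun i => ?_, ?_, fun i => ?_⟩
    · rw [hupd]
      exact div_pos (mul_pos (hpos i) (Real.exp_pos _)) hZ
    · simp_rw [hupd]
      rw [← Finset.sum_div, ← hZdef, div_self hZ.ne']
    · have hcard : (((Finset.range (n + 1)).filter fun t => p t i).card : ℝ) =
          ((Finset.range n).filter fun t => p t i).card + (if p n i then 1 else 0) := by
        rw [Finset.range_add_one, Finset.filter_insert]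
        split_ifs <;> simp
      have hstep := hle i
      rw [hcard, mul_add, Real.exp_add, hupd]
      push_cast
      rw [add_mul, one_mul, Real.exp_add]
      set E := Real.exp (-b * (if p n i then 1 else 0))
      have hE : 0 < E := Real.exp_pos _
      calc _ ≤ D n i * (N * Real.exp (n * B)) * E := by gcongr
        _ = D n i * E * (N * Real.exp (n * B)) / Z * Z := by field_simp
        _ ≤ D n i * E * (N * Real.exp (n * B)) / Z * Real.exp B := by
          have := hpos i
          gcongr
        _ = _ := by ring

/-- A majority vote is correct at a point where more than half of the hypotheses are. -/
lemma maj_eq_of_lt_card {X : Type} {k : ℕ} (h : ℕ → X → Bool) (x : X) (y : Bool)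
    (hk : k < 2 * ((Finset.range k).filter fun t => h t x = y).card) :
    maj (fun t : Fin k => h t) x = y := by
  have hcard (b : Bool) : (Finset.univ.filter fun t : Fin k => h t x = b).card =
      ((Finset.range k).filter fun t => h t x = b).card := by
    simp only [Finset.card_filter, Finset.sum_range]
  unfold maj
  rw [hcard]
  cases y with
  | true => simpa using hk.le
  | false =>
    have hadd := Finset.card_filter_add_card_filter_not (s := Finset.range k) (h · x = true)
    simp only [Bool.not_eq_true, Finset.card_range] at hadd
    simp only [decide_eq_false_iff_not]
    omega

/-- **α-Boost guarantee (Lemma 3.2).** On a dataset of `m ≥ 2` points, running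
`T = ⌈112 ln m⌉` rounds with `α = ½ ln(1 + √(2 ln m / T))`, if each hypothesis
`h_t` has error at most `1/3` under the boosting distribution `D_t` (defined by
the multiplicative update from the uniform distribution `D_0`), then every data
point is classified correctly by at least a `5/9` fraction of `h_0, …, h_{T−1}`;
in particular the majority vote classifies every point of the dataset correctly. -/
theorem alphaBoost_margin (X : Type) (m : ℕ) (hm : 2 ≤ m)
    (x : Fin m → X) (y : Fin m → Bool)
    (T : ℕ) (hT : T = ⌈(112 : ℝ) * Real.log m⌉₊)
    (α : ℝ) (hα : α = (1 / 2) * Real.log (1 + Real.sqrt (2 * Real.log m / T)))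
    (h : ℕ → X → Bool) (D : ℕ → Fin m → ℝ)
    (hD0 : ∀ i, D 0 i = 1 / m)
    (hupd : ∀ t < T, ∀ i : Fin m,
      D (t + 1) i =
        D t i * Real.exp (-(2 * α) * (if h t (x i) = y i then 1 else 0)) /
          ∑ j : Fin m, D t j * Real.exp (-(2 * α) * (if h t (x j) = y j then 1 else 0)))
    (herr : ∀ t < T, ∑ i : Fin m, D t i * (if h t (x i) ≠ y i then (1 : ℝ) else 0) ≤ 1 / 3) :
    ∀ i : Fin m,
      (5 / 9 : ℝ) * T ≤ ((Finset.range T).filter fun t => h t (x i) = y i).card ∧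
      maj (fun t : Fin T => h t) (x i) = y i := by
  intro i
  have hm' : (2 : ℝ) ≤ m := by exact_mod_cast hm
  have hlog : 0 < Real.log m := Real.log_pos (by linarith)
  have hTlog : 112 * Real.log m ≤ T := hT ▸ Nat.le_ceil _
  have hTpos : (0 : ℝ) < T := by linarith
  set γ := Real.sqrt (2 * Real.log m / T) with hγdef
  have hγ : 0 < γ := Real.sqrt_pos.mpr (by positivity)
  have hγsq : γ ^ 2 = 2 * Real.log m / T := Real.sq_sqrt (by positivity)
  have hlogm : Real.log m = T * (γ ^ 2 / 2) := by
    rw [hγsq]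
    field_simp
  have hγle : γ ^ 2 ≤ 1 / 56 := by
    rw [hγsq, div_le_iff₀ hTpos]
    linarith
  have hα2 : 2 * α = Real.log (1 + γ) := by
    rw [hα]
    ring
  rw [hα2] at hupd
  obtain ⟨hpos, hsum, hle⟩ := exp_neg_mul_card_le_weight D (fun t i => h t (x i) = y i) T
    (N := m) (by linarith) hD0
    (by simp only [hD0, Finset.sum_const, Finset.card_univ, Fintype.card_fin, nsmul_eq_mul]
        field_simp)
    hupd (fun t ht hs => sum_damped_le _ _ hs (by simpa only [ite_not] using herr t ht) hγ.le)
  have hDle : D T i ≤ 1 :=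
    hsum ▸ Finset.single_le_sum (fun j _ => (hpos j).le) (Finset.mem_univ i)
  have hexp := (hle i).trans (mul_le_of_le_one_left (by positivity) hDle)
  rw [← Real.exp_log (show (0 : ℝ) < m by linarith), ← Real.exp_add, Real.exp_le_exp,
    hlogm] at hexp
  have hlogγ : γ / 3 + γ ^ 2 / 2 ≤ 4 / 9 * Real.log (1 + γ) := by
    have hlb := Real.le_log_one_add_of_nonneg hγ.le
    have : γ / 3 + γ ^ 2 / 2 ≤ 4 / 9 * (2 * γ / (γ + 2)) := by
      have hγ1 : γ ≤ 1 / 7 := by nlinarith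
      rw [← mul_div_assoc, le_div_iff₀ (by positivity)]
      nlinarith
    linarith
  have hmargin : (5 / 9 : ℝ) * T ≤
      ((Finset.range T).filter fun t => h t (x i) = y i).card := by
    have hL : 0 < Real.log (1 + γ) := Real.log_pos (by linarith)
    refine le_of_mul_le_mul_left ?_ hL
    nlinarith [mul_le_mul_of_nonneg_left hlogγ hTpos.le]
  refine ⟨hmargin, maj_eq_of_lt_card h (x i) (y i) ?_⟩
  have : (T : ℝ) < 2 * ((Finset.range T).filter fun t => h t (x i) = y i).card := by linarith
  exact_mod_cast this
end
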